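/- There exist constants τ > 0 and c > 0 such that for every ε ∈ (0,1) the following holds for all sufficiently large n: (i) if log₂ n ≤ k ≤ 2^{(log n)^{1−ε}} and X is a distribution on {0,1}^n sampled with decision depth d ≤ τ · (log n)^ε, then Δ(X, U_k^n) ≥ 1 − n^{−ck}; (ii) if 1 ≤ k < log₂ n and X is sampled with decision depth d ≤ τ · (log n)^ε / log log n, then Δ(X, U_k^n) ≥ 1 − n^{−ck}. -/

import Mathlib

open Finset

/-- Hamming weight of a bit string. -/
def wt {n : ℕ} (x : Fin n → Bool) : ℕ := (Finset.univ.filter fun i => x i = true).card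

/-- Binary decision trees querying input bits. -/
inductive DTree (m : ℕ) : Type
  | leaf : Bool → DTree m
  | node : Fin m → DTree m → DTree m → DTree m

def DTree.eval {m : ℕ} : DTree m → (Fin m → Bool) → Bool
  | .leaf b, _ => b
  | .node i t0 t1, y => if y i then t1.eval y else t0.eval y

def DTree.depth {m : ℕ} : DTree m → ℕ
  | .leaf _ => 0
  | .node _ t0 t1 => max t0.depth t1.depth + 1

/-- `f` has decision depth `d`: every output bit is computed by a depth-`≤ d` decision tree. -/
def hasDecisionDepth {m n : ℕ} (f : (Fin m → Bool) → (Fin n → Bool)) (d : ℕ) : Prop :=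
  ∀ j : Fin n, ∃ t : DTree m, t.depth ≤ d ∧ ∀ y, f y j = t.eval y

/-- The mass function of the distribution `f(Y)` for `Y` uniform on `{0,1}^m`. -/
noncomputable def srcDist {m n : ℕ} (f : (Fin m → Bool) → (Fin n → Bool)) :
    (Fin n → Bool) → ℝ :=
  fun x => ((Finset.univ.filter fun y => f y = x).card : ℝ) / 2 ^ m

/-- The mass function of the uniform distribution on Hamming-weight-`k` strings. -/
noncomputable def uniformSlice (n k : ℕ) : (Fin n → Bool) → ℝ :=
  fun x => if wt x = k then 1 / (n.choose k : ℝ) else 0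

/-- Statistical distance between two mass functions: `max_A |P(A) - Q(A)|`. -/
noncomputable def SD {α : Type*} [Fintype α] (P Q : α → ℝ) : ℝ :=
  ⨆ A : Finset α, |∑ x ∈ A, P x - ∑ x ∈ A, Q x|

/-! ### Agreement indicators and the Janson-type inequality -/

/-- Indicator that `y` agrees with `a` on `B`. -/
noncomputable def agr {m : ℕ} (a : Fin m → Bool) (B : Finset (Fin m)) (y : Fin m → Bool) : ℝ :=
  if ∀ v ∈ B, y v = a v then 1 else 0

/-- Expectation under the uniform measure. -/
noncomputable def Ex {m : ℕ} (g : (Fin m → Bool) → ℝ) : ℝ := (∑ y, g y) / 2 ^ m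

lemma Ex_mono {m : ℕ} {g h : (Fin m → Bool) → ℝ} (H : ∀ y, g y ≤ h y) : Ex g ≤ Ex h := by
  unfold Ex
  gcongr with y
  exact H y

lemma Ex_nonneg {m : ℕ} {g : (Fin m → Bool) → ℝ} (H : ∀ y, 0 ≤ g y) : 0 ≤ Ex g := by
  unfold Ex
  exact div_nonneg (Finset.sum_nonneg fun y _ => H y) (by positivity)

lemma Ex_neg {m : ℕ} (g : (Fin m → Bool) → ℝ) : Ex (fun y => - g y) = - Ex g := by
  unfold Ex
  rw [Finset.sum_neg_distrib]; ring

lemma Ex_sub {m : ℕ} (g h : (Fin m → Bool) → ℝ) : Ex (fun y => g y - h y) = Ex g - Ex h := by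
  unfold Ex
  rw [Finset.sum_sub_distrib]; ring

lemma Ex_mul_left {m : ℕ} (c : ℝ) (g : (Fin m → Bool) → ℝ) :
    Ex (fun y => c * g y) = c * Ex g := by
  unfold Ex
  rw [← Finset.mul_sum]; ring

lemma Ex_sum {m : ℕ} {ι : Type*} (J : Finset ι) (g : ι → (Fin m → Bool) → ℝ) :
    Ex (fun y => ∑ j ∈ J, g j y) = ∑ j ∈ J, Ex (g j) := by
  unfold Ex
  rw [Finset.sum_comm, Finset.sum_div]

lemma Ex_one {m : ℕ} : Ex (fun _ : Fin m → Bool => (1 : ℝ)) = 1 := by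
  unfold Ex
  simp

lemma agr_nonneg {m : ℕ} (a : Fin m → Bool) (B : Finset (Fin m)) (y : Fin m → Bool) :
    0 ≤ agr a B y := by
  unfold agr; split_ifs <;> norm_num

lemma agr_le_one {m : ℕ} (a : Fin m → Bool) (B : Finset (Fin m)) (y : Fin m → Bool) :
    agr a B y ≤ 1 := by
  unfold agr; split_ifs <;> norm_num

lemma agr_update_of_notMem {m : ℕ} (a : Fin m → Bool) (B : Finset (Fin m)) (y : Fin m → Bool)
    (b : Fin m) (hb : b ∉ B) (c : Bool) : agr a B (Function.update y b c) = agr a B y := by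
  unfold agr
  congr 1
  apply propext
  apply forall₂_congr
  intro v hv
  rw [Function.update_of_ne (by rintro rfl; exact hb hv)]

lemma agr_update_ge {m : ℕ} (a : Fin m → Bool) (B : Finset (Fin m)) (y : Fin m → Bool)
    (b : Fin m) : agr a B y ≤ agr a B (Function.update y b (a b)) := by
  unfold agr
  by_cases h : ∀ v ∈ B, y v = a v
  · rw [if_pos h, if_pos]
    intro v hv
    by_cases hvb : v = b
    · subst hvb; simp
    · rw [Function.update_of_ne hvb]; exact h v hv
  · rw [if_neg h]; split_ifs <;> norm_num

lemma agr_union {m : ℕ} (a : Fin m → Bool) (B C : Finset (Fin m)) (y : Fin m → Bool) :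
    agr a (B ∪ C) y = agr a B y * agr a C y := by
  unfold agr
  by_cases h : ∀ v ∈ B, y v = a v <;> by_cases h' : ∀ v ∈ C, y v = a v
  · rw [if_pos h, if_pos h', if_pos]
    · norm_num
    · intro v hv
      rcases Finset.mem_union.1 hv with hv | hv
      exacts [h v hv, h' v hv]
  · rw [if_neg h', if_neg]
    · norm_num
    · exact fun H => h' fun v hv => H v (Finset.mem_union_right _ hv)
  · rw [if_neg h, if_neg]
    · norm_num
    · exact fun H => h fun v hv => H v (Finset.mem_union_left _ hv)
  · rw [if_neg h, if_neg]
    · norm_num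
    · exact fun H => h fun v hv => H v (Finset.mem_union_left _ hv)

lemma Ex_half {m : ℕ} (a : Fin m → Bool) (b : Fin m) (h : (Fin m → Bool) → ℝ)
    (H : ∀ y, h (Function.update y b (a b)) ≤ h y) :
    Ex (fun y => h y * agr a {b} y) ≤ (1 / 2) * Ex h := by
  have key : ∑ y, h y * agr a {b} y ≤ ∑ y, h y * (1 - agr a {b} y) := by
    let e : (Fin m → Bool) → (Fin m → Bool) := fun y => Function.update y b (!(y b))
    have he : Function.Involutive e := by
      intro y
      simp only [e]
      simp
    rw [← Equiv.sum_comp he.toPerm (fun y => h y * agr a {b} y)]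
    apply Finset.sum_le_sum
    intro y _
    show h (e y) * agr a {b} (e y) ≤ _
    by_cases hy : y b = a b
    · have h1 : agr a {b} (e y) = 0 := by
        unfold agr
        rw [if_neg]
        simp [e, hy]
      have h2 : agr a {b} y = 1 := by
        unfold agr
        rw [if_pos]
        simpa using hy
      rw [h1, h2]; simp
    · have hab : (!(y b)) = a b := by
        revert hy; cases y b <;> cases a b <;> simp
      have h1 : agr a {b} (e y) = 1 := by
        unfold agr
        rw [if_pos]
        simp [e, hab]
      have h2 : agr a {b} y = 0 := by
        unfold agr
        rw [if_neg]
        simpa using hy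
      rw [h1, h2]
      have := H y
      simp only [e, hab]
      simpa using this
  have : ∑ y, h y * (1 - agr a {b} y) = ∑ y, h y - ∑ y, h y * agr a {b} y := by
    rw [← Finset.sum_sub_distrib]
    exact Finset.sum_congr rfl fun y _ => by ring
  rw [this] at key
  unfold Ex
  rw [← mul_div_assoc]
  gcongr
  linarith

lemma Ex_agr_le {m : ℕ} (a : Fin m → Bool) (B : Finset (Fin m)) (g : (Fin m → Bool) → ℝ)
    (H : ∀ b ∈ B, ∀ y, g (Function.update y b (a b)) ≤ g y) :
    Ex (fun y => g y * agr a B y) ≤ (1 / 2) ^ B.card * Ex g := by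
  induction B using Finset.induction_on with
  | empty => simp [agr]
  | insert b B hb ih =>
    have h1 : (fun y => g y * agr a (insert b B) y) =
        fun y => (g y * agr a B y) * agr a {b} y := by
      funext y
      rw [Finset.insert_eq, agr_union]; ring
    rw [h1]
    refine (Ex_half a b (fun y => g y * agr a B y) ?_).trans ?_
    · intro y
      simp only [agr_update_of_notMem a B y b hb]
      exact mul_le_mul_of_nonneg_right (H b (Finset.mem_insert_self _ _) y) (agr_nonneg _ _ _)
    · have := ih fun c hc => H c (Finset.mem_insert_of_mem hc)
      rw [Finset.card_insert_of_notMem hb, pow_succ]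
      linarith

lemma Ex_agr_eq {m : ℕ} (a : Fin m → Bool) (B : Finset (Fin m)) (g : (Fin m → Bool) → ℝ)
    (H : ∀ b ∈ B, ∀ y, g (Function.update y b (a b)) = g y) :
    Ex (fun y => g y * agr a B y) = (1 / 2) ^ B.card * Ex g := by
  apply le_antisymm
  · exact Ex_agr_le a B g fun b hb y => (H b hb y).le
  · have := Ex_agr_le a B (fun y => - g y) fun b hb y => by rw [H b hb y]
    simp only [neg_mul, Ex_neg] at this
    linarith

lemma prod_ge_one_sub_sum {ι : Type*} (J : Finset ι) (x : ι → ℝ)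
    (hx : ∀ j ∈ J, 0 ≤ x j ∧ x j ≤ 1) : 1 - ∑ j ∈ J, x j ≤ ∏ j ∈ J, (1 - x j) := by
  classical
  induction J using Finset.induction_on with
  | empty => simp
  | insert b B hb ih =>
    rw [Finset.sum_insert hb, Finset.prod_insert hb]
    have h1 := ih fun j hj => hx j (Finset.mem_insert_of_mem hj)
    have h2 := hx b (Finset.mem_insert_self _ _)
    have h3 : 0 ≤ ∑ j ∈ B, x j :=
      Finset.sum_nonneg fun j hj => (hx j (Finset.mem_insert_of_mem hj)).1
    nlinarith [mul_le_mul_of_nonneg_left h1 (sub_nonneg.2 h2.2), mul_nonneg h2.1 h3]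

/-- The Janson-type bound on the thinned product. -/
lemma janson {m : ℕ} {ι : Type*} [DecidableEq ι] (a : Fin m → Bool) (S : ι → Finset (Fin m))
    (J : Finset ι) (θ : ℝ) (h0 : 0 ≤ θ) (h1 : θ ≤ 1) :
    Ex (fun y => ∏ j ∈ J, (1 - θ * agr a (S j) y)) ≤
      Real.exp (-(θ * ∑ j ∈ J, (1 / 2 : ℝ) ^ (S j).card) +
        θ ^ 2 * ∑ i ∈ J, ∑ j ∈ J, if Disjoint (S i) (S j) then 0 else
          (1 / 2 : ℝ) ^ (S i ∪ S j).card) := by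
  have hx : ∀ j y, 0 ≤ θ * agr a (S j) y ∧ θ * agr a (S j) y ≤ 1 := fun j y =>
    ⟨mul_nonneg h0 (agr_nonneg _ _ _),
      mul_le_one₀ h1 (agr_nonneg _ _ _) (agr_le_one _ _ _)⟩
  have hq : ∀ i j, (0 : ℝ) ≤ if Disjoint (S i) (S j) then 0 else
      (1 / 2 : ℝ) ^ (S i ∪ S j).card := by
    intro i j; split_ifs <;> positivity
  induction J using Finset.induction_on with
  | empty => simp [Ex_one]
  | insert i J hi ih =>
    set q : ι → ι → ℝ := fun i j => if Disjoint (S i) (S j) then 0 else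
      (1 / 2 : ℝ) ^ (S i ∪ S j).card with hqdef
    set G : (Fin m → Bool) → ℝ := fun y => ∏ j ∈ J, (1 - θ * agr a (S j) y) with hG
    set G1 : (Fin m → Bool) → ℝ :=
      fun y => ∏ j ∈ J with ¬ Disjoint (S i) (S j), (1 - θ * agr a (S j) y) with hG1
    set G2 : (Fin m → Bool) → ℝ :=
      fun y => ∏ j ∈ J with Disjoint (S i) (S j), (1 - θ * agr a (S j) y) with hG2
    have hG12 : ∀ y, G y = G2 y * G1 y := fun y =>
      (Finset.prod_filter_mul_prod_filter_not J (fun j => Disjoint (S i) (S j)) _).symm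
    have hG2n : ∀ y, 0 ≤ G2 y := fun y => Finset.prod_nonneg fun j _ => by linarith [(hx j y).2]
    have hGn : ∀ y, 0 ≤ G y := fun y => Finset.prod_nonneg fun j _ => by linarith [(hx j y).2]
    have hG1le : ∀ y, G1 y ≤ 1 := fun y => Finset.prod_le_one
      (fun j _ => by linarith [(hx j y).2]) (fun j _ => by linarith [(hx j y).1])
    have hG1ge : ∀ y, 1 - ∑ j ∈ J with ¬ Disjoint (S i) (S j), θ * agr a (S j) y ≤ G1 y :=
      fun y => prod_ge_one_sub_sum _ _ fun j _ => hx j y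
    have hG2mono : ∀ b y, G2 (Function.update y b (a b)) ≤ G2 y := by
      intro b y
      apply Finset.prod_le_prod
      · intro j _; linarith [(hx j (Function.update y b (a b))).2]
      · intro j _
        have := mul_le_mul_of_nonneg_left (agr_update_ge a (S j) y b) h0
        linarith
    have hG2eq : ∀ b ∈ S i, ∀ y, G2 (Function.update y b (a b)) = G2 y := by
      intro b hb y
      apply Finset.prod_congr rfl
      intro j hj
      rw [agr_update_of_notMem]
      exact Finset.disjoint_left.1 (Finset.mem_filter.1 hj).2 hb
    set p : ℝ := (1 / 2 : ℝ) ^ (S i).card with hp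
    set Q : ℝ := ∑ j ∈ J, q i j with hQ
    have hQ' : Q = ∑ j ∈ J with ¬ Disjoint (S i) (S j), (1 / 2 : ℝ) ^ (S i ∪ S j).card := by
      rw [Finset.sum_filter]
      apply Finset.sum_congr rfl
      intro j _
      simp only [hqdef]
      by_cases h : Disjoint (S i) (S j) <;> simp [h]
    have hEG2 : Ex G ≤ Ex G2 := Ex_mono fun y => by
      rw [hG12]; exact mul_le_of_le_one_right (hG2n y) (hG1le y)
    have hEGI0 : 0 ≤ Ex (fun y => G y * agr a (S i) y) :=
      Ex_nonneg fun y => mul_nonneg (hGn y) (agr_nonneg _ _ _)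
    have hEG0 : 0 ≤ Ex G := Ex_nonneg hGn
    have hmain : Ex G2 * (p - θ * Q) ≤ Ex (fun y => G y * agr a (S i) y) := by
      have e1 : Ex (fun y => G2 y * agr a (S i) y - θ *
          ∑ j ∈ J with ¬ Disjoint (S i) (S j), G2 y * agr a (S i ∪ S j) y) ≤
          Ex (fun y => G y * agr a (S i) y) := by
        apply Ex_mono
        intro y
        rw [hG12]
        have := mul_le_mul_of_nonneg_left (hG1ge y)
          (mul_nonneg (hG2n y) (agr_nonneg a (S i) y))
        calc _ = G2 y * agr a (S i) y * (1 - ∑ j ∈ J with ¬ Disjoint (S i) (S j),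
              θ * agr a (S j) y) := by
              rw [mul_sub, mul_one, ← Finset.mul_sum, Finset.mul_sum, Finset.mul_sum,
                Finset.mul_sum]
              congr 1
              apply Finset.sum_congr rfl
              intro j _
              rw [agr_union]; ring
          _ ≤ _ := this
          _ = _ := by ring
      refine le_trans ?_ e1
      rw [Ex_sub, Ex_mul_left, Ex_sum, Ex_agr_eq a (S i) G2 hG2eq]
      have e2 : ∑ j ∈ J with ¬ Disjoint (S i) (S j), Ex (fun y => G2 y * agr a (S i ∪ S j) y) ≤
          Q * Ex G2 := by
        rw [hQ', Finset.sum_mul]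
        exact Finset.sum_le_sum fun j _ => Ex_agr_le a _ G2 fun b _ y => hG2mono b y
      have := mul_le_mul_of_nonneg_left e2 h0
      linarith
    have hmain2 : Ex G * (p - θ * Q) ≤ Ex (fun y => G y * agr a (S i) y) := by
      by_cases hs : 0 ≤ p - θ * Q
      · exact (mul_le_mul_of_nonneg_right hEG2 hs).trans hmain
      · exact (mul_nonpos_of_nonneg_of_nonpos hEG0 (by linarith)).trans hEGI0
    have hstep : Ex (fun y => ∏ j ∈ insert i J, (1 - θ * agr a (S j) y)) ≤
        Ex G * Real.exp (-(θ * p) + θ ^ 2 * Q) := by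
      have : (fun y => ∏ j ∈ insert i J, (1 - θ * agr a (S j) y)) =
          fun y => G y - θ * (G y * agr a (S i) y) := by
        funext y
        rw [Finset.prod_insert hi]; simp only [hG]; ring
      rw [this, Ex_sub, Ex_mul_left]
      have e3 := Real.add_one_le_exp (-(θ * p) + θ ^ 2 * Q)
      have e4 := mul_le_mul_of_nonneg_left e3 hEG0
      have e5 := mul_le_mul_of_nonneg_left hmain2 h0
      nlinarith
    refine hstep.trans ((mul_le_mul_of_nonneg_right ih (Real.exp_nonneg _)).trans ?_)
    rw [← Real.exp_add]
    apply Real.exp_le_exp.2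
    rw [Finset.sum_insert hi]
    have e6 : ∑ i ∈ J, ∑ j ∈ J, q i j + Q ≤ ∑ k ∈ insert i J, ∑ j ∈ insert i J, q k j := by
      rw [Finset.sum_insert hi, add_comm]
      apply add_le_add
      · exact Finset.sum_le_sum_of_subset_of_nonneg (Finset.subset_insert _ _)
          fun j _ _ => hq i j
      · exact Finset.sum_le_sum fun k _ => Finset.sum_le_sum_of_subset_of_nonneg
          (Finset.subset_insert _ _) fun j _ _ => hq k j
    have := mul_le_mul_of_nonneg_left e6 (sq_nonneg θ)
    simp only [hqdef, hp, hQ] at this ⊢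
    linarith

/-! ### Spread families and cores -/

lemma pow_bound (d s : ℕ) (hs : s ≤ d) (L R : ℝ) (hL : 1 ≤ L) (hR : R = 8 * (d + 1) * L) :
    (1 + 2 / R) ^ s - 1 ≤ 1 / (2 * L) := by
  have hd : (0 : ℝ) ≤ d := Nat.cast_nonneg d
  have hR0 : 0 < R := by rw [hR]; positivity
  have h2 : 0 ≤ 2 / R := by positivity
  have h3 : (1 + 2 / R) ^ s ≤ Real.exp (d * (2 / R)) := by
    calc (1 + 2 / R) ^ s ≤ (1 + 2 / R) ^ d := pow_le_pow_right₀ (by linarith) hs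
      _ ≤ (Real.exp (2 / R)) ^ d := by
        apply pow_le_pow_left₀ (by linarith)
        linarith [Real.add_one_le_exp (2 / R)]
      _ = _ := by rw [← Real.exp_nat_mul]
  have h4 : d * (2 / R) ≤ 1 / (4 * L) := by
    rw [hR, mul_div_assoc', div_le_div_iff₀ (by positivity) (by positivity)]
    nlinarith
  have h5 : 1 / (4 * L) ≤ 1 := by
    rw [div_le_one (by positivity)]; linarith
  have h6 : 0 ≤ d * (2 / R) := by positivity
  have h7 := Real.abs_exp_sub_one_le (x := d * (2 / R)) (by rw [abs_of_nonneg h6]; linarith)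
  rw [abs_of_nonneg h6] at h7
  have h8 := le_abs_self (Real.exp (d * (2 / R)) - 1)
  have h9 : 1 / (2 * L) = 2 * (1 / (4 * L)) := by field_simp; norm_num
  rw [h9]
  linarith

lemma spread_delta {m : ℕ} {ι : Type*} [DecidableEq ι] (S : ι → Finset (Fin m))
    (J : Finset ι) (d : ℕ) (L R μ : ℝ) (hL : 1 ≤ L) (hR : R = 8 * (d + 1) * L)
    (hS : ∀ j ∈ J, (S j).card ≤ d) (hμ : μ = ∑ j ∈ J, (1 / 2 : ℝ) ^ (S j).card)
    (hspread : ∀ i ∈ J, ∀ U ⊆ S i, U ≠ ∅ →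
      ∑ j ∈ J with U ⊆ S j, (1 / 2 : ℝ) ^ (S j).card ≤ μ * (1 / R) ^ U.card) :
    ∑ i ∈ J, ∑ j ∈ J, (if Disjoint (S i) (S j) then 0 else
          (1 / 2 : ℝ) ^ (S i ∪ S j).card) ≤ μ ^ 2 * (1 / (2 * L)) := by
  have hd : (0 : ℝ) ≤ d := Nat.cast_nonneg d
  have hR0 : 0 < R := by rw [hR]; positivity
  have hμ0 : 0 ≤ μ := by rw [hμ]; positivity
  have hrow : ∀ i ∈ J, ∑ j ∈ J, (if Disjoint (S i) (S j) then 0 else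
      (1 / 2 : ℝ) ^ (S i ∪ S j).card) ≤ (1 / 2 : ℝ) ^ (S i).card * (μ * (1 / (2 * L))) := by
    intro i hi
    have e1 : ∀ j ∈ J, (if Disjoint (S i) (S j) then 0 else
      (1 / 2 : ℝ) ^ (S i ∪ S j).card) ≤ ∑ U ∈ (S i).powerset.erase ∅,
        if U ⊆ S j then (1 / 2 : ℝ) ^ (S i).card * 2 ^ U.card * (1 / 2 : ℝ) ^ (S j).card
          else 0 := by
      intro j _
      split_ifs with hdis
      · apply Finset.sum_nonneg
        intro U _
        split_ifs <;> positivity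
      · have hU : S i ∩ S j ∈ (S i).powerset.erase ∅ := by
          rw [Finset.mem_erase, Finset.mem_powerset]
          exact ⟨fun h => hdis (Finset.disjoint_iff_inter_eq_empty.2 h),
            Finset.inter_subset_left⟩
        refine le_trans ?_ (Finset.single_le_sum (f := fun U => if U ⊆ S j then
          (1 / 2 : ℝ) ^ (S i).card * 2 ^ U.card * (1 / 2 : ℝ) ^ (S j).card
          else 0) (fun U _ => ?_) hU)
        · simp only [Finset.inter_subset_right, if_true]
          have hc := Finset.card_union_add_card_inter (S i) (S j)
          have : (1 / 2 : ℝ) ^ (S i).card * (1 / 2 : ℝ) ^ (S j).card =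
              (1 / 2 : ℝ) ^ (S i ∪ S j).card * (1 / 2 : ℝ) ^ (S i ∩ S j).card := by
            rw [← pow_add, ← pow_add, hc]
          have h2 : (1 / 2 : ℝ) ^ (S i ∩ S j).card * 2 ^ (S i ∩ S j).card = 1 := by
            rw [← mul_pow]; norm_num
          apply le_of_eq
          calc _ = (1 / 2 : ℝ) ^ (S i ∪ S j).card *
                ((1 / 2 : ℝ) ^ (S i ∩ S j).card * 2 ^ (S i ∩ S j).card) := by rw [h2, mul_one]
            _ = ((1 / 2 : ℝ) ^ (S i ∪ S j).card * (1 / 2 : ℝ) ^ (S i ∩ S j).card) *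
                2 ^ (S i ∩ S j).card := by ring
            _ = _ := by rw [← this]; ring
        · split_ifs <;> positivity
    refine (Finset.sum_le_sum e1).trans ?_
    rw [Finset.sum_comm]
    have e2 : ∀ U ∈ (S i).powerset.erase ∅, (∑ j ∈ J, if U ⊆ S j then
        (1 / 2 : ℝ) ^ (S i).card * 2 ^ U.card * (1 / 2 : ℝ) ^ (S j).card else 0) ≤
        (1 / 2 : ℝ) ^ (S i).card * μ * (2 / R) ^ U.card := by
      intro U hU
      rw [Finset.mem_erase, Finset.mem_powerset] at hU
      rw [← Finset.sum_filter, ← Finset.mul_sum]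
      have := mul_le_mul_of_nonneg_left (hspread i hi U hU.2 hU.1)
        (show (0 : ℝ) ≤ (1 / 2 : ℝ) ^ (S i).card * 2 ^ U.card by positivity)
      refine this.trans (le_of_eq ?_)
      have : (2 / R) ^ U.card = 2 ^ U.card * (1 / R) ^ U.card := by
        rw [← mul_pow]; congr 1; ring
      rw [this]; ring
    refine (Finset.sum_le_sum e2).trans ?_
    rw [← Finset.mul_sum, mul_assoc]
    apply mul_le_mul_of_nonneg_left _ (by positivity)
    apply mul_le_mul_of_nonneg_left _ hμ0
    have e3 : ∑ U ∈ (S i).powerset, (2 / R) ^ U.card = (2 / R + 1) ^ (S i).card := by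
      rw [← Finset.sum_pow_mul_eq_add_pow]
      simp
    have e4 := Finset.sum_erase_add (S i).powerset (fun U => (2 / R) ^ U.card)
      (Finset.empty_mem_powerset (S i))
    simp only [Finset.card_empty, pow_zero] at e4
    have := pow_bound d (S i).card (hS i hi) L R hL hR
    rw [add_comm] at this
    linarith
  refine (Finset.sum_le_sum hrow).trans ?_
  rw [← Finset.sum_mul, ← hμ]
  apply le_of_eq; ring

lemma spread_tail {m : ℕ} {ι : Type*} [DecidableEq ι] (a : Fin m → Bool)
    (S : ι → Finset (Fin m))
    (J : Finset ι) (d k : ℕ) (L R μ : ℝ) (hL : 1 ≤ L) (hR : R = 8 * (d + 1) * L)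
    (hS : ∀ j ∈ J, (S j).card ≤ d) (hμ : μ = ∑ j ∈ J, (1 / 2 : ℝ) ^ (S j).card)
    (hμL : 2 * L ≤ μ)
    (hspread : ∀ i ∈ J, ∀ U ⊆ S i, U ≠ ∅ →
      ∑ j ∈ J with U ⊆ S j, (1 / 2 : ℝ) ^ (S j).card ≤ μ * (1 / R) ^ U.card) :
    (((Finset.univ.filter fun y : Fin m → Bool =>
      (J.filter fun j => ∀ v ∈ S j, y v = a v).card ≤ k).card : ℕ) : ℝ) ≤
      2 ^ k * Real.exp (-(L / 2)) * 2 ^ m := by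
  have hμ0 : 0 < μ := by linarith
  set θ : ℝ := L / μ with hθ
  have hθ0 : 0 ≤ θ := by positivity
  have hθ2 : θ ≤ 1 / 2 := by
    rw [hθ, div_le_iff₀ hμ0]; linarith
  have hθμ : θ * μ = L := by rw [hθ]; field_simp
  have hj := janson a S J θ hθ0 (by linarith)
  have hδ := spread_delta S J d L R μ hL hR hS hμ hspread
  have h1 : Ex (fun y => ∏ j ∈ J, (1 - θ * agr a (S j) y)) ≤ Real.exp (-(L / 2)) := by
    refine hj.trans (Real.exp_le_exp.2 ?_)
    rw [← hμ, hθμ]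
    have h2 := mul_le_mul_of_nonneg_left hδ (sq_nonneg θ)
    have h3 : θ ^ 2 * (μ ^ 2 * (1 / (2 * L))) = L / 2 := by
      rw [← mul_assoc, ← mul_pow, hθμ]
      have : L ≠ 0 := by linarith
      field_simp
    linarith
  have h2 : ∀ y, ∏ j ∈ J, (1 - θ * agr a (S j) y) =
      (1 - θ) ^ (J.filter fun j => ∀ v ∈ S j, y v = a v).card := by
    intro y
    rw [← Finset.prod_const, Finset.prod_filter]
    apply Finset.prod_congr rfl
    intro j _
    unfold agr
    split_ifs <;> simp
  have h3 : (((Finset.univ.filter fun y : Fin m → Bool =>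
      (J.filter fun j => ∀ v ∈ S j, y v = a v).card ≤ k).card : ℕ) : ℝ) * (1 / 2) ^ k ≤
      ∑ y, ∏ j ∈ J, (1 - θ * agr a (S j) y) := by
    rw [← nsmul_eq_mul, ← Finset.sum_const]
    refine le_trans ?_ (Finset.sum_le_sum_of_subset_of_nonneg (Finset.subset_univ
      (Finset.univ.filter fun y : Fin m → Bool =>
        (J.filter fun j => ∀ v ∈ S j, y v = a v).card ≤ k)) ?_)
    · apply Finset.sum_le_sum
      intro y hy
      rw [h2]
      have hy := (Finset.mem_filter.1 hy).2
      calc (1 / 2 : ℝ) ^ k ≤ (1 - θ) ^ k := pow_le_pow_left₀ (by norm_num) (by linarith) k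
        _ ≤ _ := pow_le_pow_of_le_one (by linarith) (by linarith) hy
    · intro y _ _
      rw [h2]
      exact pow_nonneg (by linarith) _
  unfold Ex at h1
  rw [div_le_iff₀ (by positivity)] at h1
  have h4 := h3.trans h1
  have h5 : (1 / 2 : ℝ) ^ k * 2 ^ k = 1 := by rw [← mul_pow]; norm_num
  calc _ = (((Finset.univ.filter fun y : Fin m → Bool =>
      (J.filter fun j => ∀ v ∈ S j, y v = a v).card ≤ k).card : ℕ) : ℝ) * (1 / 2) ^ k * 2 ^ k := by
        rw [mul_assoc, h5, mul_one]
    _ ≤ (Real.exp (-(L / 2)) * 2 ^ m) * 2 ^ k :=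
        mul_le_mul_of_nonneg_right h4 (by positivity)
    _ = _ := by ring

lemma core {m : ℕ} {ι : Type*} [DecidableEq ι] (a : Fin m → Bool)
    (S : ι → Finset (Fin m))
    (J : Finset ι) (d k : ℕ) (L R : ℝ) (hL : 1 ≤ L) (hR : R = 8 * (d + 1) * L)
    (hS : ∀ j ∈ J, (S j).card ≤ d) (hJ : 2 * L * R ^ d ≤ J.card) :
    ∃ K : Finset (Fin m), (∃ j ∈ J, K ⊆ S j) ∧
    (((Finset.univ.filter fun y : Fin m → Bool => (∀ v ∈ K, y v = a v) ∧
      (J.filter fun j => ∀ v ∈ S j, y v = a v).card ≤ k).card : ℕ) : ℝ) ≤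
      2 ^ k * Real.exp (-(L / 2)) * 2 ^ m := by
  have hd : (0 : ℝ) ≤ d := Nat.cast_nonneg d
  have hR8 : 8 ≤ R := by rw [hR]; nlinarith
  have hR0 : 0 < R := by linarith
  set D : Finset (Fin m) → ℝ := fun K => ∑ j ∈ J with K ⊆ S j, (1 / 2 : ℝ) ^ (S j).card with hD
  obtain ⟨K, -, hK⟩ := Finset.exists_max_image (Finset.univ : Finset (Finset (Fin m)))
    (fun K => D K * R ^ K.card) Finset.univ_nonempty
  have hK : ∀ K', D K' * R ^ K'.card ≤ D K * R ^ K.card := fun K' => hK K' (Finset.mem_univ _)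
  have hD0 : (J.card : ℝ) * (1 / 2) ^ d ≤ D ∅ := by
    have hf : J.filter (fun j => ∅ ⊆ S j) = J :=
      Finset.filter_true_of_mem fun j _ => Finset.empty_subset _
    simp only [hD]
    rw [hf]
    rw [← nsmul_eq_mul, ← Finset.sum_const]
    apply Finset.sum_le_sum
    intro j hj
    exact pow_le_pow_of_le_one (by norm_num) (by norm_num) (hS j hj)
  have hJ0 : (0 : ℝ) < J.card := lt_of_lt_of_le (by positivity) hJ
  have hD0' : 0 < D ∅ := lt_of_lt_of_le (by positivity) hD0
  have hK0 := hK ∅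
  simp only [Finset.card_empty, pow_zero, mul_one] at hK0
  have hDK : 0 < D K := by
    have : 0 < D K * R ^ K.card := lt_of_lt_of_le hD0' hK0
    exact pos_of_mul_pos_left this (by positivity)
  have hex : ∃ j ∈ J, K ⊆ S j := by
    by_contra hcon
    push Not at hcon
    have : D K = 0 := by
      simp only [hD]
      rw [Finset.filter_false_of_mem hcon, Finset.sum_empty]
    linarith
  refine ⟨K, hex, ?_⟩
  obtain ⟨j0, hj0, hKj0⟩ := hex
  have hKd : K.card ≤ d := (Finset.card_le_card hKj0).trans (hS j0 hj0)
  set JK := J.filter fun j => K ⊆ S j with hJK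
  set S' : ι → Finset (Fin m) := fun j => S j \ K with hS'
  have hp : ∀ j ∈ JK, (1 / 2 : ℝ) ^ (S' j).card = 2 ^ K.card * (1 / 2 : ℝ) ^ (S j).card := by
    intro j hj
    have hKS := (Finset.mem_filter.1 hj).2
    have hc : (S' j).card + K.card = (S j).card := Finset.card_sdiff_add_card_eq_card hKS
    rw [← hc, pow_add]
    have h5 : (1 / 2 : ℝ) ^ K.card * 2 ^ K.card = 1 := by rw [← mul_pow]; norm_num
    calc (1 / 2 : ℝ) ^ (S' j).card = (1 / 2 : ℝ) ^ (S' j).card *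
        ((1 / 2 : ℝ) ^ K.card * 2 ^ K.card) := by rw [h5, mul_one]
      _ = _ := by ring
  have hμ : ∑ j ∈ JK, (1 / 2 : ℝ) ^ (S' j).card = 2 ^ K.card * D K := by
    rw [Finset.sum_congr rfl hp, ← Finset.mul_sum]
  have hμL : 2 * L ≤ 2 ^ K.card * D K := by
    have h1 : 2 * L * R ^ d * (1 / 2) ^ d ≤ D K * R ^ K.card :=
      (mul_le_mul_of_nonneg_right hJ (by positivity)).trans (hD0.trans hK0)
    have h2 : (R / 2) ^ K.card ≤ (R / 2) ^ d := pow_le_pow_right₀ (by linarith) hKd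
    have h3 : (R / 2) ^ d = R ^ d * (1 / 2) ^ d := by rw [← mul_pow]; congr 1; ring
    have h4 : R ^ K.card = (R / 2) ^ K.card * 2 ^ K.card := by rw [← mul_pow]; congr 1; ring
    have h5 : 2 * L * (R / 2) ^ K.card ≤ (2 ^ K.card * D K) * (R / 2) ^ K.card := by
      calc _ ≤ 2 * L * (R / 2) ^ d := by gcongr
        _ = 2 * L * R ^ d * (1 / 2) ^ d := by rw [h3]; ring
        _ ≤ _ := h1
        _ = _ := by rw [h4]; ring
    exact le_of_mul_le_mul_right h5 (by positivity)
  have ht := spread_tail a S' JK d k L R (2 ^ K.card * D K) hL hR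
    (fun j hj => (Finset.card_le_card Finset.sdiff_subset).trans
      (hS j (Finset.mem_filter.1 hj).1)) hμ.symm hμL ?_
  · refine le_trans ?_ ht
    norm_cast
    apply Finset.card_le_card
    intro y hy
    rw [Finset.mem_filter] at hy ⊢
    obtain ⟨-, hyK, hy⟩ := hy
    refine ⟨Finset.mem_univ _, le_trans (Finset.card_le_card ?_) hy⟩
    intro j hj
    rw [Finset.mem_filter] at hj ⊢
    refine ⟨(Finset.mem_filter.1 hj.1).1, ?_⟩
    intro v hv
    by_cases hvK : v ∈ K
    · exact hyK v hvK
    · exact hj.2 v (Finset.mem_sdiff.2 ⟨hv, hvK⟩)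
  · intro i hi U hU _
    have hUK : Disjoint K U := by
      rw [Finset.disjoint_left]
      intro v hv hvU
      exact (Finset.mem_sdiff.1 (hU hvU)).2 hv
    have h1 : ∑ j ∈ JK with U ⊆ S' j, (1 / 2 : ℝ) ^ (S' j).card ≤ 2 ^ K.card * D (K ∪ U) := by
      simp only [hD]
      rw [Finset.mul_sum]
      have : ∀ j ∈ JK.filter (fun j => U ⊆ S' j), (1 / 2 : ℝ) ^ (S' j).card =
          2 ^ K.card * (1 / 2 : ℝ) ^ (S j).card := fun j hj => hp j (Finset.mem_filter.1 hj).1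
      rw [Finset.sum_congr rfl this]
      apply Finset.sum_le_sum_of_subset_of_nonneg
      · intro j hj
        simp only [Finset.mem_filter, hJK] at hj ⊢
        exact ⟨hj.1.1, Finset.union_subset hj.1.2 (hj.2.trans Finset.sdiff_subset)⟩
      · intro j _ _; positivity
    refine h1.trans ?_
    have h2 := hK (K ∪ U)
    rw [Finset.card_union_of_disjoint hUK, pow_add] at h2
    have h3 : D (K ∪ U) * R ^ U.card ≤ D K := by
      apply le_of_mul_le_mul_right _ (show 0 < R ^ K.card by positivity)
      calc _ = D (K ∪ U) * (R ^ K.card * R ^ U.card) := by ring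
        _ ≤ _ := h2
    rw [mul_assoc]
    apply mul_le_mul_of_nonneg_left _ (by positivity)
    rw [one_div, inv_pow, ← div_eq_mul_inv, le_div_iff₀ (by positivity)]
    exact h3

/-! ### Terms of decision trees -/

/-- The terms (sets of literals along paths) leading to leaves labelled `true`. -/
def DTree.terms {m : ℕ} : DTree m → Finset (Finset (Fin m × Bool))
  | .leaf b => if b then {∅} else ∅
  | .node i t0 t1 => t0.terms.image (insert (i, false)) ∪ t1.terms.image (insert (i, true))

/-- `y` satisfies every literal of `T`. -/
def Sat {m : ℕ} (y : Fin m → Bool) (T : Finset (Fin m × Bool)) : Prop := ∀ l ∈ T, y l.1 = l.2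

instance {m : ℕ} (y : Fin m → Bool) (T : Finset (Fin m × Bool)) : Decidable (Sat y T) := by
  unfold Sat; infer_instance

lemma sat_insert {m : ℕ} (y : Fin m → Bool) (T : Finset (Fin m × Bool)) (i : Fin m) (b : Bool) :
    Sat y (insert (i, b) T) ↔ y i = b ∧ Sat y T := by
  unfold Sat
  simp only [Finset.forall_mem_insert]

lemma terms_eval {m : ℕ} (t : DTree m) (y : Fin m → Bool) :
    t.eval y = true ↔ ∃ T ∈ t.terms, Sat y T := by
  induction t with
  | leaf b => cases b <;> simp [DTree.eval, DTree.terms, Sat]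
  | node i t0 t1 ih0 ih1 =>
    simp only [DTree.eval, DTree.terms, Finset.mem_union, Finset.mem_image]
    constructor
    · intro h
      by_cases hy : y i = true
      · rw [if_pos hy] at h
        obtain ⟨T, hT, hs⟩ := ih1.1 h
        exact ⟨_, Or.inr ⟨T, hT, rfl⟩, (sat_insert _ _ _ _).2 ⟨hy, hs⟩⟩
      · rw [if_neg hy] at h
        obtain ⟨T, hT, hs⟩ := ih0.1 h
        exact ⟨_, Or.inl ⟨T, hT, rfl⟩, (sat_insert _ _ _ _).2 ⟨by simpa using hy, hs⟩⟩
    · rintro ⟨_, ⟨T, hT, rfl⟩ | ⟨T, hT, rfl⟩, hs⟩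
      · obtain ⟨hy, hs⟩ := (sat_insert _ _ _ _).1 hs
        simp only [hy]
        exact ih0.2 ⟨T, hT, hs⟩
      · obtain ⟨hy, hs⟩ := (sat_insert _ _ _ _).1 hs
        simp only [hy]
        exact ih1.2 ⟨T, hT, hs⟩

lemma terms_unique {m : ℕ} (t : DTree m) (y : Fin m → Bool) (T T' : Finset (Fin m × Bool))
    (hT : T ∈ t.terms) (hT' : T' ∈ t.terms) (hs : Sat y T) (hs' : Sat y T') : T = T' := by
  induction t generalizing T T' with
  | leaf b =>
    cases b
    · simp [DTree.terms] at hT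
    · simp [DTree.terms] at hT hT'
      rw [hT, hT']
  | node i t0 t1 ih0 ih1 =>
    simp only [DTree.terms, Finset.mem_union, Finset.mem_image] at hT hT'
    obtain ⟨T, hT, rfl⟩ | ⟨T, hT, rfl⟩ := hT <;> obtain ⟨T', hT', rfl⟩ | ⟨T', hT', rfl⟩ := hT' <;>
      obtain ⟨hy, hs⟩ := (sat_insert _ _ _ _).1 hs <;>
      obtain ⟨hy', hs'⟩ := (sat_insert _ _ _ _).1 hs'
    · rw [ih0 T T' hT hT' hs hs']
    · rw [hy] at hy'; cases hy'
    · rw [hy] at hy'; cases hy'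
    · rw [ih1 T T' hT hT' hs hs']

lemma terms_card {m : ℕ} (t : DTree m) : t.terms.card ≤ 2 ^ t.depth := by
  induction t with
  | leaf b => cases b <;> simp [DTree.terms, DTree.depth]
  | node i t0 t1 ih0 ih1 =>
    simp only [DTree.terms, DTree.depth]
    refine (Finset.card_union_le _ _).trans ?_
    have h0 := (Finset.card_image_le (s := t0.terms) (f := insert (i, false))).trans ih0
    have h1 := (Finset.card_image_le (s := t1.terms) (f := insert (i, true))).trans ih1
    have h2 : 2 ^ t0.depth ≤ 2 ^ max t0.depth t1.depth :=
      Nat.pow_le_pow_right (by norm_num) (le_max_left _ _)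
    have h3 : 2 ^ t1.depth ≤ 2 ^ max t0.depth t1.depth :=
      Nat.pow_le_pow_right (by norm_num) (le_max_right _ _)
    rw [pow_succ]
    omega

lemma terms_width {m : ℕ} (t : DTree m) (T : Finset (Fin m × Bool)) (hT : T ∈ t.terms) :
    T.card ≤ t.depth := by
  induction t generalizing T with
  | leaf b =>
    cases b
    · simp [DTree.terms] at hT
    · simp [DTree.terms] at hT
      simp [hT]
  | node i t0 t1 ih0 ih1 =>
    simp only [DTree.terms, Finset.mem_union, Finset.mem_image] at hT
    simp only [DTree.depth]
    obtain ⟨T, hT, rfl⟩ | ⟨T, hT, rfl⟩ := hT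
    · exact (Finset.card_insert_le _ _).trans
        (Nat.add_le_add_right ((ih0 T hT).trans (le_max_left _ _)) 1)
    · exact (Finset.card_insert_le _ _).trans
        (Nat.add_le_add_right ((ih1 T hT).trans (le_max_right _ _)) 1)

lemma sat_iff {m : ℕ} (a y : Fin m → Bool) (T : Finset (Fin m × Bool)) (ha : Sat a T) :
    Sat y T ↔ ∀ v ∈ T.image Prod.fst, y v = a v := by
  unfold Sat at *
  simp only [Finset.forall_mem_image]
  apply forall₂_congr
  intro l hl
  rw [ha l hl]

/-- The number of inputs satisfying a satisfiable term of width at most `d`. -/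
lemma sat_count {m : ℕ} (a : Fin m → Bool) (T : Finset (Fin m × Bool)) (ha : Sat a T) (d : ℕ)
    (hd : T.card ≤ d) :
    (1 / 2 : ℝ) ^ d * 2 ^ m ≤ ((Finset.univ.filter fun y => Sat y T).card : ℝ) := by
  have h := Ex_agr_eq a (T.image Prod.fst) (fun _ => 1) (fun _ _ _ => rfl)
  rw [Ex_one, mul_one] at h
  unfold Ex at h
  rw [div_eq_iff (by positivity)] at h
  have h2 : ∑ y, 1 * agr a (T.image Prod.fst) y =
      ((Finset.univ.filter fun y => Sat y T).card : ℝ) := by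
    rw [Finset.card_filter]
    push_cast
    apply Finset.sum_congr rfl
    intro y _
    unfold agr
    simp only [sat_iff a y T ha, one_mul]
  rw [← h2, h]
  apply mul_le_mul_of_nonneg_right _ (by positivity)
  exact pow_le_pow_of_le_one (by norm_num) (by norm_num) (Finset.card_image_le.trans hd)

/-- What we use about a system of terms representing `f`. -/
structure TermSys {m n : ℕ} (f : (Fin m → Bool) → (Fin n → Bool)) (d : ℕ)
    (F : Finset (Fin n × Finset (Fin m × Bool))) : Prop where
  width : ∀ p ∈ F, p.2.card ≤ d
  cons : ∀ p ∈ F, ∃ y, Sat y p.2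
  uniq : ∀ p ∈ F, ∀ q ∈ F, ∀ y, p.1 = q.1 → Sat y p.2 → Sat y q.2 → p = q
  sound : ∀ p ∈ F, ∀ y, Sat y p.2 → f y p.1 = true
  compl : ∀ y j, f y j = true → ∃ p ∈ F, p.1 = j ∧ Sat y p.2
  card : F.card ≤ n * 2 ^ d

lemma exists_termSys {m n : ℕ} (f : (Fin m → Bool) → (Fin n → Bool)) (d : ℕ)
    (hf : hasDecisionDepth f d) : ∃ F, TermSys f d F := by
  classical
  choose t ht hft using hf
  refine ⟨Finset.univ.biUnion fun j => (((t j).terms.filter fun T => ∃ y, Sat y T).image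
    fun T => (j, T)), ?_⟩
  have hmem : ∀ p : Fin n × Finset (Fin m × Bool), p ∈ (Finset.univ.biUnion fun j =>
      (((t j).terms.filter fun T => ∃ y, Sat y T).image fun T => (j, T))) ↔
      p.2 ∈ (t p.1).terms ∧ ∃ y, Sat y p.2 := by
    rintro ⟨j, T⟩
    simp only [Finset.mem_biUnion, Finset.mem_univ, true_and, Finset.mem_image,
      Finset.mem_filter, Prod.mk.injEq]
    constructor
    · rintro ⟨j', T', h, rfl, rfl⟩
      exact h
    · intro h
      exact ⟨j, T, h, rfl, rfl⟩
  constructor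
  · intro p hp
    exact (terms_width _ _ ((hmem p).1 hp).1).trans (ht p.1)
  · intro p hp
    exact ((hmem p).1 hp).2
  · rintro ⟨j, T⟩ hp ⟨j', T'⟩ hq y h hs hs'
    simp only at h hs hs'
    subst h
    rw [terms_unique (t j) y T T' ((hmem _).1 hp).1 ((hmem _).1 hq).1 hs hs']
  · intro p hp y hs
    rw [hft]
    exact (terms_eval _ _).2 ⟨p.2, ((hmem p).1 hp).1, hs⟩
  · intro y j h
    rw [hft] at h
    obtain ⟨T, hT, hs⟩ := (terms_eval _ _).1 h
    exact ⟨(j, T), (hmem _).2 ⟨hT, y, hs⟩, rfl, hs⟩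
  · refine Finset.card_biUnion_le.trans ?_
    have : ∀ j ∈ (Finset.univ : Finset (Fin n)), (((t j).terms.filter fun T => ∃ y, Sat y T).image
        fun T => (j, T)).card ≤ 2 ^ d := by
      intro j _
      refine Finset.card_image_le.trans ((Finset.card_filter_le _ _).trans ?_)
      exact (terms_card (t j)).trans (Nat.pow_le_pow_right (by norm_num) (ht j))
    refine (Finset.sum_le_card_nsmul _ _ _ this).trans ?_
    simp

lemma select {m n : ℕ} (f : (Fin m → Bool) → (Fin n → Bool)) (d k : ℕ)
    (F : Finset (Fin n × Finset (Fin m × Bool))) (hF : TermSys f d F)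
    (L R : ℝ) (hL : 1 ≤ L) (hR : R = 8 * (d + 1) * L)
    (G : Finset (Fin n × Finset (Fin m × Bool))) (hG : G ⊆ F)
    (hGc : 2 * L * (2 * R) ^ d ≤ G.card) :
    ∃ p ∈ G, ∃ T ⊆ p.2, (((Finset.univ.filter fun y : Fin m → Bool =>
      Sat y T ∧ wt (f y) ≤ k).card : ℕ) : ℝ) ≤ 2 ^ k * Real.exp (-(L / 2)) * 2 ^ m := by
  classical
  -- choose the sign pattern
  obtain ⟨a, ha⟩ : ∃ a : Fin m → Bool,
      (G.card : ℝ) * (1 / 2) ^ d ≤ ((G.filter fun p => Sat a p.2).card : ℝ) := by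
    by_contra hcon
    push Not at hcon
    have h1 : ∑ a : Fin m → Bool, ((G.filter fun p => Sat a p.2).card : ℝ) <
        ∑ _a : Fin m → Bool, (G.card : ℝ) * (1 / 2) ^ d :=
      Finset.sum_lt_sum_of_nonempty Finset.univ_nonempty fun a _ => hcon a
    have h2 : ∑ a : Fin m → Bool, ((G.filter fun p => Sat a p.2).card : ℝ) =
        ∑ p ∈ G, ((Finset.univ.filter fun a => Sat a p.2).card : ℝ) := by
      simp only [Finset.card_filter]
      push_cast
      rw [Finset.sum_comm]
    have h3 : ∑ p ∈ G, (1 / 2 : ℝ) ^ d * 2 ^ m ≤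
        ∑ p ∈ G, ((Finset.univ.filter fun a => Sat a p.2).card : ℝ) := by
      apply Finset.sum_le_sum
      intro p hp
      obtain ⟨y, hy⟩ := hF.cons p (hG hp)
      exact sat_count y p.2 hy d (hF.width p (hG hp))
    rw [h2] at h1
    have h4 := h3.trans_lt h1
    simp only [Finset.sum_const, nsmul_eq_mul, Finset.card_univ, Fintype.card_pi,
      Fintype.card_bool, Finset.prod_const, Fintype.card_fin] at h4
    push_cast at h4
    apply lt_irrefl _ (h4.trans_le (le_of_eq _))
    ring
  set J := G.filter fun p => Sat a p.2 with hJ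
  have hJc : 2 * L * R ^ d ≤ J.card := by
    refine le_trans ?_ ha
    have h1 := mul_le_mul_of_nonneg_right hGc (show (0 : ℝ) ≤ (1 / 2) ^ d by positivity)
    refine le_trans (le_of_eq ?_) h1
    rw [mul_assoc (2 * L), ← mul_pow]
    congr 2; ring
  obtain ⟨K, ⟨p, hp, hKp⟩, hK⟩ := core a (fun p => p.2.image Prod.fst) J d k L R hL hR
    (fun p hp => Finset.card_image_le.trans (hF.width p (hG (Finset.mem_filter.1 hp).1))) hJc
  refine ⟨p, (Finset.mem_filter.1 hp).1, p.2.filter fun l => l.1 ∈ K, Finset.filter_subset _ _, ?_⟩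
  refine le_trans ?_ hK
  norm_cast
  apply Finset.card_le_card
  intro y hy
  rw [Finset.mem_filter] at hy ⊢
  refine ⟨hy.1, ?_, le_trans ?_ hy.2.2⟩
  · intro v hv
    obtain ⟨l, hl, rfl⟩ := Finset.mem_image.1 (hKp hv)
    rw [hy.2.1 l (Finset.mem_filter.2 ⟨hl, hv⟩), (Finset.mem_filter.1 hp).2 l hl]
  · unfold wt
    apply Finset.card_le_card_of_injOn (fun q => q.1)
    · intro q hq
      have hq := Finset.mem_filter.1 (Finset.mem_coe.1 hq)
      have hq1 := Finset.mem_filter.1 hq.1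
      simp only [Finset.coe_filter, Finset.mem_univ, true_and, Set.mem_ofPred_eq]
      exact hF.sound q (hG hq1.1) y ((sat_iff a y q.2 hq1.2).2 hq.2)
    · intro q hq r hr hqr
      have hq := Finset.mem_filter.1 (Finset.mem_coe.1 hq)
      have hr := Finset.mem_filter.1 (Finset.mem_coe.1 hr)
      have hq1 := Finset.mem_filter.1 hq.1
      have hr1 := Finset.mem_filter.1 hr.1
      exact hF.uniq q (hG hq1.1) r (hG hr1.1) a hqr hq1.2 hr1.2

lemma iterate_aux {m n : ℕ} (f : (Fin m → Bool) → (Fin n → Bool)) (d k : ℕ)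
    (F : Finset (Fin n × Finset (Fin m × Bool))) (hF : TermSys f d F)
    (L R : ℝ) (hL : 1 ≤ L) (hR : R = 8 * (d + 1) * L) (N : ℕ) :
    ∀ G : Finset (Fin n × Finset (Fin m × Bool)), G ⊆ F → G.card ≤ N →
    ∃ G' ⊆ G, (G'.card : ℝ) ≤ 2 * L * (2 * R) ^ d ∧
      (((Finset.univ.filter fun y : Fin m → Bool =>
        wt (f y) ≤ k ∧ ∃ p ∈ G, p ∉ G' ∧ Sat y p.2).card : ℕ) : ℝ) ≤
        N * (2 ^ k * Real.exp (-(L / 2)) * 2 ^ m) := by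
  classical
  induction N with
  | zero =>
    intro G _ hGc
    have : G = ∅ := Finset.card_eq_zero.1 (by omega)
    subst this
    have hR0 : 0 ≤ R := by rw [hR]; positivity
    refine ⟨∅, le_refl _, ?_, ?_⟩
    · simp only [Finset.card_empty, Nat.cast_zero]; positivity
    · simp
  | succ N ih =>
    intro G hGF hGc
    by_cases hM : 2 * L * (2 * R) ^ d ≤ G.card
    · obtain ⟨p, hp, T, hT, hTc⟩ := select f d k F hF L R hL hR G hGF hM
      obtain ⟨G', hG', hG'c, hG'b⟩ := ih (G.filter fun q => ¬ T ⊆ q.2)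
        ((Finset.filter_subset _ _).trans hGF) (by
          have : (G.filter fun q => ¬ T ⊆ q.2) ⊂ G := by
            refine Finset.filter_ssubset.2 ⟨p, hp, ?_⟩
            simpa using hT
          have := Finset.card_lt_card this
          omega)
      refine ⟨G', hG'.trans (Finset.filter_subset _ _), hG'c, ?_⟩
      push_cast
      rw [add_mul, one_mul]
      refine le_trans ?_ (add_le_add hG'b hTc)
      norm_cast
      refine le_trans (Finset.card_le_card ?_) (Finset.card_union_le _ _)
      intro y hy
      simp only [Finset.mem_union, Finset.mem_filter, Finset.mem_univ, true_and] at hy ⊢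
      obtain ⟨hw, q, hq, hqG', hs⟩ := hy
      by_cases hTq : T ⊆ q.2
      · right
        exact ⟨fun l hl => hs l (hTq hl), hw⟩
      · left
        exact ⟨hw, q, ⟨hq, hTq⟩, hqG', hs⟩
    · refine ⟨G, le_refl _, (not_le.1 hM).le, ?_⟩
      have : (Finset.univ.filter fun y : Fin m → Bool =>
        wt (f y) ≤ k ∧ ∃ p ∈ G, p ∉ G ∧ Sat y p.2) = ∅ := by
        apply Finset.filter_false_of_mem
        rintro y _ ⟨_, p, h, h', _⟩
        exact h' h
      rw [this]
      simp only [Finset.card_empty, Nat.cast_zero]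
      positivity

/-- The main structural result: low-weight outputs are essentially supported on few coordinates. -/
lemma structure_thm {m n : ℕ} (f : (Fin m → Bool) → (Fin n → Bool)) (d k : ℕ)
    (hf : hasDecisionDepth f d) (L R : ℝ) (hL : 1 ≤ L) (hR : R = 8 * (d + 1) * L) :
    ∃ J : Finset (Fin n), (J.card : ℝ) ≤ 2 * L * (2 * R) ^ d ∧
      (((Finset.univ.filter fun y : Fin m → Bool =>
        wt (f y) = k ∧ ∃ j, f y j = true ∧ j ∉ J).card : ℕ) : ℝ) ≤
        n * 2 ^ d * (2 ^ k * Real.exp (-(L / 2))) * 2 ^ m := by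
  classical
  obtain ⟨F, hF⟩ := exists_termSys f d hf
  obtain ⟨G, hGF, hGc, hGb⟩ := iterate_aux f d k F hF L R hL hR (n * 2 ^ d) F (le_refl _) hF.card
  refine ⟨G.image Prod.fst, le_trans ?_ hGc, ?_⟩
  · exact_mod_cast Finset.card_image_le
  · push_cast at hGb
    refine le_trans ?_ (hGb.trans (le_of_eq (by ring)))
    norm_cast
    apply Finset.card_le_card
    intro y hy
    simp only [Finset.mem_filter, Finset.mem_univ, true_and] at hy ⊢
    obtain ⟨hw, j, hj, hjG⟩ := hy
    obtain ⟨p, hp, rfl, hs⟩ := hF.compl y j hj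
    exact ⟨hw.le, p, hp, fun h => hjG (Finset.mem_image_of_mem _ h), hs⟩

/-! ### The test, and the numerical estimates -/

lemma slice_card {n : ℕ} (k : ℕ) (J : Finset (Fin n)) :
    (Finset.univ.filter fun x : Fin n → Bool => wt x = k ∧ ∀ j, x j = true → j ∈ J).card =
      J.card.choose k := by
  classical
  rw [← Finset.card_powersetCard]
  refine Finset.card_bij' (fun x _ => Finset.univ.filter fun i => x i = true)
    (fun s _ => fun i => decide (i ∈ s)) ?_ ?_ ?_ ?_
  · intro x hx
    simp only [Finset.mem_filter, Finset.mem_univ, true_and] at hx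
    rw [Finset.mem_powersetCard]
    refine ⟨?_, hx.1⟩
    intro j hj
    exact hx.2 j (by simpa using hj)
  · intro s hs
    rw [Finset.mem_powersetCard] at hs
    refine Finset.mem_filter.2 ⟨Finset.mem_univ _, ?_, fun j hj => hs.1 (of_decide_eq_true hj)⟩
    rw [← hs.2]
    unfold wt
    congr 1
    ext; simp
  · intro x _
    funext i
    simp
  · intro s _
    ext; simp

lemma SD_ge {α : Type*} [Fintype α] (P Q : α → ℝ) (A : Finset α) :
    ∑ x ∈ A, Q x - ∑ x ∈ A, P x ≤ SD P Q := by
  unfold SD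
  refine le_trans ?_ (le_ciSup (f := fun A : Finset α => |∑ x ∈ A, P x - ∑ x ∈ A, Q x|)
    (Set.finite_range _).bddAbove A)
  have := neg_abs_le (∑ x ∈ A, P x - ∑ x ∈ A, Q x)
  linarith

lemma SD_lower {m n : ℕ} (f : (Fin m → Bool) → (Fin n → Bool)) (k : ℕ) (hk : k ≤ n)
    (J : Finset (Fin n)) :
    1 - (J.card.choose k : ℝ) / (n.choose k : ℝ) -
      (((Finset.univ.filter fun y : Fin m → Bool =>
        wt (f y) = k ∧ ∃ j, f y j = true ∧ j ∉ J).card : ℕ) : ℝ) / 2 ^ m ≤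
      SD (srcDist f) (uniformSlice n k) := by
  classical
  set A := Finset.univ.filter fun x : Fin n → Bool => wt x = k ∧ ∃ j, x j = true ∧ j ∉ J with hA
  refine le_trans (le_of_eq ?_) (SD_ge _ _ A)
  have hc : (0 : ℝ) < n.choose k := by exact_mod_cast Nat.choose_pos hk
  congr 1
  · have h1 : ∑ x ∈ A, uniformSlice n k x = (A.card : ℝ) * (1 / n.choose k) := by
      rw [← nsmul_eq_mul, ← Finset.sum_const]
      apply Finset.sum_congr rfl
      intro x hx
      unfold uniformSlice
      rw [if_pos (Finset.mem_filter.1 hx).2.1]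
    have h2 : J.card.choose k + A.card = n.choose k := by
      have h3 := slice_card k (Finset.univ : Finset (Fin n))
      rw [Finset.card_univ, Fintype.card_fin] at h3
      rw [← h3, ← slice_card k J, ← Finset.card_union_of_disjoint]
      · congr 1
        ext x
        simp only [hA, Finset.mem_union, Finset.mem_filter, Finset.mem_univ, true_and]
        constructor
        · rintro (h | h)
          · exact ⟨h.1, fun _ _ => trivial⟩
          · exact ⟨h.1, fun _ _ => trivial⟩
        · intro h
          by_cases hh : ∀ j, x j = true → j ∈ J
          · exact Or.inl ⟨h.1, hh⟩
          · push Not at hh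
            exact Or.inr ⟨h.1, hh⟩
      · rw [Finset.disjoint_left]
        intro x hx hx'
        obtain ⟨j, hj, hjJ⟩ := (Finset.mem_filter.1 hx').2.2
        exact hjJ ((Finset.mem_filter.1 hx).2.2 j hj)
    rw [h1]
    have h4 : (J.card.choose k : ℝ) + A.card = n.choose k := by exact_mod_cast h2
    field_simp
    linarith
  · unfold srcDist
    rw [← Finset.sum_div]
    congr 1
    norm_cast
    rw [Finset.card_eq_sum_card_fiberwise (f := f) (t := A)]
    · apply Finset.sum_congr rfl
      intro x hx
      congr 1
      ext y
      simp only [Finset.mem_filter, Finset.mem_univ, true_and]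
      constructor
      · exact fun h => h.2
      · rintro rfl
        exact ⟨(Finset.mem_filter.1 hx).2, rfl⟩
    · intro y hy
      have := (Finset.mem_filter.1 (Finset.mem_coe.1 hy)).2
      exact Finset.mem_coe.2 (Finset.mem_filter.2 ⟨Finset.mem_univ _, this⟩)

lemma choose_ratio (n k M : ℕ) (x : ℝ) (hx : 2 ≤ x) (hn : (n : ℝ) = x ^ 4)
    (hk : (k : ℝ) ≤ 2 * x) (hM : (M : ℝ) ≤ x) :
    k ≤ n ∧ (M.choose k : ℝ) / (n.choose k : ℝ) ≤ (1 / x ^ 2) ^ k := by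
  have hx4 : 4 * x ≤ x ^ 4 := by nlinarith [mul_nonneg (show 0 ≤ x by linarith) (show 0 ≤ x ^ 3 - 4 by nlinarith [sq_nonneg x, sq_nonneg (x - 2)])]
  have hkn : (k : ℝ) ≤ n := by rw [hn]; linarith
  have hkn' : k ≤ n := by exact_mod_cast hkn
  refine ⟨hkn', ?_⟩
  have hc : (0 : ℝ) < n.choose k := by exact_mod_cast Nat.choose_pos hkn'
  rw [div_le_iff₀ hc]
  have h1 : (M.choose k : ℝ) ≤ (M : ℝ) ^ k / k.factorial := Nat.choose_le_pow_div k M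
  have h2 : (((n + 1 - k : ℕ) : ℝ) ^ k) / k.factorial ≤ n.choose k := by
    have := Nat.pow_le_choose (α := ℝ) k n
    exact_mod_cast this
  have h3 : x ^ 4 / 2 ≤ ((n + 1 - k : ℕ) : ℝ) := by
    rw [Nat.cast_sub (by omega)]
    push_cast
    rw [hn]; linarith
  have h4 : (M : ℝ) ≤ 1 / x ^ 2 * (x ^ 4 / 2) := by
    have : 1 / x ^ 2 * (x ^ 4 / 2) = x ^ 2 / 2 := by
      have : x ≠ 0 := by linarith
      field_simp
    rw [this]; nlinarith
  calc (M.choose k : ℝ) ≤ (M : ℝ) ^ k / k.factorial := h1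
    _ ≤ (1 / x ^ 2 * (x ^ 4 / 2)) ^ k / k.factorial := by gcongr
    _ ≤ (1 / x ^ 2 * ((n + 1 - k : ℕ) : ℝ)) ^ k / k.factorial := by gcongr
    _ = (1 / x ^ 2) ^ k * ((((n + 1 - k : ℕ) : ℝ) ^ k) / k.factorial) := by rw [mul_pow]; ring
    _ ≤ _ := by gcongr

lemma M_bound (d : ℕ) (kk ℓ s : ℝ) (hk0 : 0 ≤ kk) (hℓ0 : 0 ≤ ℓ) (hs : 384 ≤ s) (hk : kk ≤ 2 * s)
    (hℓ : ℓ ≤ s) (hd : (d : ℝ) + 1 ≤ s) (h1 : Real.log s ≤ ℓ / 24)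
    (h2 : d * Real.log s ≤ ℓ / 32) :
    2 * (12 * kk * ℓ) * (2 * (8 * (d + 1) * (12 * kk * ℓ))) ^ d ≤ Real.exp (ℓ / 4) := by
  have hs0 : 0 < s := by linarith
  have hd0 : (0 : ℝ) ≤ d := Nat.cast_nonneg d
  have hL : 12 * kk * ℓ ≤ 24 * s ^ 2 := by
    calc 12 * kk * ℓ ≤ 12 * (2 * s) * s := by gcongr
      _ = _ := by ring
  have hR : 2 * (8 * ((d : ℝ) + 1) * (12 * kk * ℓ)) ≤ s ^ 4 := by
    calc 2 * (8 * ((d : ℝ) + 1) * (12 * kk * ℓ)) ≤ 2 * (8 * s * (24 * s ^ 2)) := by gcongr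
      _ = 384 * s ^ 3 := by ring
      _ ≤ s * s ^ 3 := by gcongr
      _ = _ := by ring
  calc 2 * (12 * kk * ℓ) * (2 * (8 * (d + 1) * (12 * kk * ℓ))) ^ d
      ≤ s ^ 3 * (s ^ 4) ^ d := by
        apply mul_le_mul _ (pow_le_pow_left₀ (by positivity) hR d) (by positivity) (by positivity)
        calc 2 * (12 * kk * ℓ) ≤ 48 * s ^ 2 := by linarith
          _ ≤ s * s ^ 2 := by gcongr; linarith
          _ = _ := by ring
    _ = Real.exp ((3 + 4 * d) * Real.log s) := by
        have : ((3 : ℝ) + 4 * d) = ((3 + 4 * d : ℕ) : ℝ) := by push_cast; ring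
        rw [this, Real.exp_nat_mul, Real.exp_log hs0, pow_add, pow_mul]
    _ ≤ _ := Real.exp_le_exp.2 (by nlinarith)

lemma final_bound {m n : ℕ} (f : (Fin m → Bool) → (Fin n → Bool)) (d k : ℕ)
    (hf : hasDecisionDepth f d) (s : ℝ) (hk1 : 1 ≤ k) (hn : 0 < n)
    (hs : 384 ≤ s) (hk : (k : ℝ) ≤ 2 * s) (hℓ1 : 384 ≤ Real.log n)
    (hℓ : Real.log n ≤ s) (hd : (d : ℝ) + 1 ≤ s) (h1 : Real.log s ≤ Real.log n / 24)
    (h2 : d * Real.log s ≤ Real.log n / 32) :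
    1 - (n : ℝ) ^ (-(1 / 4 * (k : ℝ))) ≤ SD (srcDist f) (uniformSlice n k) := by
  set ℓ := Real.log n with hℓdef
  have hk1' : (1 : ℝ) ≤ k := by exact_mod_cast hk1
  have hn0 : (0 : ℝ) < n := by exact_mod_cast hn
  set x := Real.exp (ℓ / 4) with hx
  have hxn : (n : ℝ) = x ^ 4 := by
    rw [hx, ← Real.exp_nat_mul]
    push_cast
    rw [mul_div_cancel₀ _ (by norm_num), Real.exp_log hn0]
  have hx4 : 4 ≤ x := by
    have := Real.add_one_le_exp (ℓ / 4)
    linarith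
  have hx0 : 0 < x := by linarith
  have hsx : s ≤ x := by
    rw [← Real.exp_log (show 0 < s by linarith)]
    exact Real.exp_le_exp.2 (by linarith)
  have hL : 1 ≤ 12 * (k : ℝ) * ℓ := by nlinarith
  obtain ⟨J, hJ, hJb⟩ := structure_thm f d k hf (12 * k * ℓ) (8 * (d + 1) * (12 * k * ℓ)) hL rfl
  have hJx : (J.card : ℝ) ≤ x := hJ.trans
    (M_bound d k ℓ s (by linarith) (by linarith) hs hk hℓ hd h1 h2)
  obtain ⟨hkn, hr⟩ := choose_ratio n k J.card x (by linarith) hxn (by linarith) hJx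
  refine le_trans ?_ (SD_lower f k hkn J)
  have hpow : (n : ℝ) ^ (-(1 / 4 * (k : ℝ))) = (1 / x) ^ k := by
    rw [Real.rpow_def_of_pos hn0, one_div x, hx, ← Real.exp_neg, ← Real.exp_nat_mul]
    congr 1
    ring
  have hb : (((Finset.univ.filter fun y : Fin m → Bool =>
        wt (f y) = k ∧ ∃ j, f y j = true ∧ j ∉ J).card : ℕ) : ℝ) / 2 ^ m ≤
        n * 2 ^ d * (2 ^ k * Real.exp (-(12 * k * ℓ / 2))) := by
    rw [div_le_iff₀ (by positivity)]
    exact hJb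
  have hxk : (1 / x) ^ k ≤ 1 / 2 := by
    calc (1 / x) ^ k ≤ (1 / x) ^ 1 := by
          apply pow_le_pow_of_le_one (by positivity) _ hk1
          rw [div_le_one hx0]; linarith
      _ ≤ 1 / 2 := by rw [pow_one]; apply one_div_le_one_div_of_le <;> linarith
  have hxk0 : 0 ≤ (1 / x) ^ k := by positivity
  have e1 : (1 / x ^ 2) ^ k ≤ 1 / 2 * (1 / x) ^ k := by
    have : (1 / x ^ 2) ^ k = (1 / x) ^ k * (1 / x) ^ k := by
      rw [← mul_pow]; congr 1; field_simp
    rw [this]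
    exact mul_le_mul_of_nonneg_right hxk hxk0
  have e2 : n * 2 ^ d * (2 ^ k * Real.exp (-(12 * k * ℓ / 2))) ≤ 1 / 2 * (1 / x) ^ k := by
    have hd2 : (2 : ℝ) ^ d ≤ x := by
      calc (2 : ℝ) ^ d ≤ s ^ d := by gcongr; linarith
        _ = Real.exp (d * Real.log s) := by
          rw [Real.exp_nat_mul, Real.exp_log (by linarith)]
        _ ≤ x := Real.exp_le_exp.2 (by linarith)
    have hk2 : (2 : ℝ) ^ k ≤ x ^ k := by gcongr; linarith
    have he : Real.exp (-(12 * k * ℓ / 2)) = (1 / x) ^ (24 * k) := by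
      rw [one_div, ← Real.exp_neg, ← Real.exp_nat_mul]
      congr 1
      push_cast; ring
    have hxx : x ^ k * (1 / x) ^ k = 1 := by
      rw [← mul_pow, mul_one_div_cancel hx0.ne', one_pow]
    have h5 : x ^ 5 ≤ x ^ (5 * k) := pow_le_pow_right₀ (by linarith) (by omega)
    have hi1 : 1 / x ≤ 1 := by rw [div_le_one hx0]; linarith
    calc n * 2 ^ d * (2 ^ k * Real.exp (-(12 * k * ℓ / 2)))
        ≤ x ^ 4 * x * (x ^ k * (1 / x) ^ (24 * k)) := by
          rw [hxn, he]; gcongr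
      _ = x ^ 5 * (x ^ k * (1 / x) ^ (24 * k)) := by ring
      _ ≤ x ^ (5 * k) * (x ^ k * (1 / x) ^ (24 * k)) := by gcongr
      _ = (x ^ k * (1 / x) ^ k) ^ 6 * ((1 / x) ^ k) ^ 18 := by ring
      _ = ((1 / x) ^ k) ^ 18 := by rw [hxx]; ring
      _ ≤ ((1 / x) ^ k) ^ 2 := by
          apply pow_le_pow_of_le_one hxk0 (by linarith) (by norm_num)
      _ ≤ _ := by rw [sq]; exact mul_le_mul_of_nonneg_right hxk hxk0
  rw [hpow]
  linarith

/-- There are constants `τ, c > 0` such that for every `ε ∈ (0,1)` and all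
sufficiently large `n`: (i) if `log₂ n ≤ k ≤ 2^{(log n)^{1-ε}}` and `X` is sampled with
decision depth `d ≤ τ (log n)^ε`, then `Δ(X, U_k^n) ≥ 1 - n^{-ck}`; (ii) if `1 ≤ k < log₂ n`
and `X` is sampled with decision depth `d ≤ τ (log n)^ε / log log n`, then the same bound
holds. -/
theorem stmt1 :
    ∃ τ c : ℝ, 0 < τ ∧ 0 < c ∧ ∀ ε : ℝ, 0 < ε → ε < 1 → ∃ N : ℕ, ∀ n : ℕ, N ≤ n →
      ∀ (k m d : ℕ) (f : (Fin m → Bool) → (Fin n → Bool)), hasDecisionDepth f d →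
        ((Real.logb 2 n ≤ (k : ℝ) ∧ (k : ℝ) ≤ (2 : ℝ) ^ ((Real.log n) ^ (1 - ε)) ∧
            (d : ℝ) ≤ τ * (Real.log n) ^ ε) ∨
          (1 ≤ k ∧ (k : ℝ) < Real.logb 2 n ∧
            (d : ℝ) ≤ τ * (Real.log n) ^ ε / Real.log (Real.log n))) →
        1 - (n : ℝ) ^ (-(c * (k : ℝ))) ≤ SD (srcDist f) (uniformSlice n k) := by
  refine ⟨1 / 32, 1 / 4, by norm_num, by norm_num, ?_⟩
  intro ε hε0 hε1
  have hlog : Filter.Tendsto (fun n : ℕ => Real.log (n : ℝ)) Filter.atTop Filter.atTop :=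
    Real.tendsto_log_atTop.comp tendsto_natCast_atTop_atTop
  have hE : ∀ᶠ ℓ : ℝ in Filter.atTop, 384 ≤ ℓ ∧ 24 ≤ ℓ ^ ε ∧ Real.log ℓ ≤ ℓ / 24 := by
    have h1 := (tendsto_rpow_atTop hε0).eventually_ge_atTop 24
    have h2 := Real.isLittleO_log_id_atTop.bound (show (0 : ℝ) < 1 / 24 by norm_num)
    filter_upwards [Filter.eventually_ge_atTop 384, h1, h2] with ℓ h0 h1 h2
    refine ⟨h0, h1, ?_⟩
    have h3 := (le_abs_self _).trans h2
    simp only [id, Real.norm_eq_abs] at h3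
    rw [abs_of_nonneg (by linarith)] at h3
    linarith
  obtain ⟨N, hN⟩ := Filter.eventually_atTop.1 (hlog.eventually hE)
  refine ⟨max N 1, ?_⟩
  intro n hn k m d f hf hcase
  obtain ⟨hℓ, hℓε, hlogℓ⟩ := hN n ((le_max_left _ _).trans hn)
  have hn1 : 1 ≤ n := (le_max_right _ _).trans hn
  have hn0 : (0 : ℝ) < n := by exact_mod_cast hn1
  set ℓ := Real.log (n : ℝ) with hℓdef
  have hℓ0 : 0 < ℓ := by linarith
  have hℓεle : ℓ ^ ε ≤ ℓ := by
    conv_rhs => rw [← Real.rpow_one ℓ]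
    exact Real.rpow_le_rpow_of_exponent_le (by linarith) hε1.le
  have hprod : ℓ ^ ε * ℓ ^ (1 - ε) = ℓ := by
    rw [← Real.rpow_add hℓ0]; simp
  have hl2 : Real.log 2 ≤ 1 := by linarith [Real.log_two_lt_d9]
  have hl2' : 1 / 2 ≤ Real.log 2 := by linarith [Real.log_two_gt_d9]
  have hlogb : Real.logb 2 n = ℓ / Real.log 2 := rfl
  rcases hcase with ⟨hk1, hk2, hd⟩ | ⟨hk1, hk2, hd⟩
  · have hkℓ : ℓ ≤ k := by
      refine le_trans ?_ hk1
      rw [hlogb, le_div_iff₀ (by linarith)]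
      nlinarith
    have hk0 : (0 : ℝ) < k := by linarith
    have hkpos : 1 ≤ k := by
      have : 0 < k := by exact_mod_cast hk0
      exact this
    have hpos : 0 < ℓ ^ (1 - ε) := Real.rpow_pos_of_pos hℓ0 _
    have hlk : Real.log k ≤ ℓ ^ (1 - ε) := by
      have := Real.log_le_log hk0 hk2
      rw [Real.log_rpow (by norm_num)] at this
      nlinarith
    have hlk0 : 0 ≤ Real.log k := Real.log_nonneg (by linarith)
    apply final_bound f d k hf k hkpos hn1 (by linarith) (by linarith) hℓ hkℓ
    · linarith
    · nlinarith
    · calc (d : ℝ) * Real.log k ≤ (1 / 32 * ℓ ^ ε) * ℓ ^ (1 - ε) := by gcongr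
        _ = ℓ / 32 := by rw [mul_assoc, hprod]; ring
  · have hlℓ : 1 ≤ Real.log ℓ := by
      rw [Real.le_log_iff_exp_le hℓ0]
      linarith [Real.exp_one_lt_d9]
    rw [le_div_iff₀ (by linarith)] at hd
    have hd0 : (0 : ℝ) ≤ d := Nat.cast_nonneg d
    apply final_bound f d k hf ℓ hk1 hn1 hℓ _ hℓ le_rfl
    · nlinarith
    · exact hlogℓ
    · linarith
    · refine hk2.le.trans ?_
      rw [hlogb, div_le_iff₀ (by linarith)]
      nlinarith
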